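/- Let ψ : ℝ^d → ℝ be a continuous function with compact support that is not identically zero. Then the linear span of the translates {ψ(· − t) : t ∈ ℝ^d} is dense in C₀(ℝ^d) with respect to the supremum norm. -/

import Mathlib

open MeasureTheory

section Translates

open scoped FourierTransform

variable {E : Type*} [NormedAddCommGroup E] [InnerProductSpace ℝ E] [FiniteDimensional ℝ E]
  [MeasurableSpace E] [BorelSpace E]

/-- The exponential integral of a continuous compactly supported function is entire. -/
theorem differentiable_integral_cexp_mul {f a : E → ℂ} (hf : Continuous f)
    (hs : HasCompactSupport f) (ha : Continuous a) :
    Differentiable ℂ fun z : ℂ ↦ ∫ x, Complex.exp (z * a x) * f x := by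
  intro z₀
  obtain ⟨C, hC⟩ := (hs.isCompact.image ha).isBounded.exists_norm_le
  have hcs (z : ℂ) : Continuous fun x ↦ Complex.exp (z * a x) * f x := by fun_prop
  have hbound (z : ℂ) (hz : z ∈ Metric.ball z₀ 1) (x : E) :
      ‖a x * Complex.exp (z * a x) * f x‖ ≤ C * Real.exp ((‖z₀‖ + 1) * C) * ‖f x‖ := by
    by_cases hx : f x = 0
    · simp [hx]
    have hax : ‖a x‖ ≤ C := hC _ ⟨x, subset_tsupport f hx, rfl⟩
    have hzn : ‖z‖ ≤ ‖z₀‖ + 1 := by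
      have h1 := norm_sub_norm_le z z₀
      have h2 := (mem_ball_iff_norm.1 hz).le
      linarith
    have hC0 : 0 ≤ C := (norm_nonneg _).trans hax
    rw [norm_mul, norm_mul]
    gcongr
    refine (Complex.norm_exp_le_exp_norm _).trans (Real.exp_le_exp.2 ?_)
    rw [norm_mul]
    gcongr
  refine (hasDerivAt_integral_of_dominated_loc_of_deriv_le
    (F' := fun z x ↦ a x * Complex.exp (z * a x) * f x)
    (bound := fun x ↦ C * Real.exp ((‖z₀‖ + 1) * C) * ‖f x‖)
    (Metric.ball_mem_nhds z₀ one_pos) (.of_forall fun z ↦ (hcs z).aestronglyMeasurable)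
    ((hcs z₀).integrable_of_hasCompactSupport hs.mul_left) ?_
    (.of_forall fun x z hz ↦ hbound z hz x)
    (((hf.integrable_of_hasCompactSupport hs).norm).const_mul _)
    (.of_forall fun x z _ ↦ ?_)).2.differentiableAt
  · exact Continuous.aestronglyMeasurable (by fun_prop)
  · have h := (((hasDerivAt_id z).mul_const (a x)).cexp).mul_const (f x)
    simpa [mul_comm] using h

theorem ae_fourier_line_ne_zero {f : E → ℂ} (hf : Continuous f) (hs : HasCompactSupport f)
    {ξ : E} (hξ : 𝓕 f ξ ≠ 0) (v : E) : ∀ᵐ t : ℝ, 𝓕 f (ξ + t • v) ≠ 0 := by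
  let a : E → ℂ := fun x ↦ ((-2 * Real.pi * inner ℝ x v : ℝ) : ℂ) * Complex.I
  let b : E → ℂ := fun x ↦ Complex.exp (((-2 * Real.pi * inner ℝ x ξ : ℝ) : ℂ) * Complex.I)
  let G : ℂ → ℂ := fun z ↦ ∫ x, Complex.exp (z * a x) * (b x * f x)
  have hG : Differentiable ℂ G :=
    differentiable_integral_cexp_mul (by fun_prop) hs.mul_left (by fun_prop)
  have hGt (t : ℝ) : G t = 𝓕 f (ξ + t • v) := by
    rw [Real.fourier_eq']
    refine integral_congr_ae (.of_forall fun x ↦ ?_)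
    simp only [a, b, smul_eq_mul, ← mul_assoc, ← Complex.exp_add, inner_add_right,
      inner_smul_right]
    congr 2
    push_cast
    ring
  have hGan : AnalyticOnNhd ℝ (fun t : ℝ ↦ G t) Set.univ := fun t _ ↦
    (hG.analyticAt (t : ℂ)).restrictScalars.comp (Complex.ofRealCLM.analyticAt t)
  have h0 : G (0 : ℝ) ≠ 0 := by rw [hGt]; simpa using hξ
  have h := ae_restrict_le_codiscreteWithin (μ := volume) MeasurableSet.univ
    (hGan.preimage_zero_mem_codiscrete (x := 0) h0)
  rw [Measure.restrict_univ] at h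
  filter_upwards [h] with t ht
  rw [← hGt]
  exact ht

theorem contDiff_fourier_of_hasCompactSupport {f : E → ℂ} (hf : Continuous f)
    (hs : HasCompactSupport f) : ContDiff ℝ ((⊤ : ℕ∞) : WithTop ℕ∞) (𝓕 f) :=
  Real.contDiff_fourier fun _ _ ↦
    Continuous.integrable_of_hasCompactSupport (by fun_prop) hs.norm.mul_left

/-- The Fourier transform of a nonzero continuous compactly supported function vanishes only on
a null set. -/
theorem ae_fourier_ne_zero {f : E → ℂ} (hf : Continuous f) (hs : HasCompactSupport f)
    (hne : f ≠ 0) : ∀ᵐ ξ, 𝓕 f ξ ≠ 0 := by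
  have hcont : Continuous (𝓕 f) := (contDiff_fourier_of_hasCompactSupport hf hs).continuous
  obtain ⟨ξ, hξ⟩ : ∃ ξ, 𝓕 f ξ ≠ 0 := by
    by_contra! h
    have h0 : 𝓕 f = 0 := funext h
    refine hne ?_
    rw [← hf.fourierInv_fourier_eq (hf.integrable_of_hasCompactSupport hs)
      (h0 ▸ integrable_zero _ _ _), h0]
    ext x
    simp [Real.fourierInv_eq]
  have hae : ∀ᵐ t : ℝ, ∀ᵐ v : E, 𝓕 f (ξ + t • v) ≠ 0 := by
    rw [Measure.ae_ae_comm]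
    · exact .of_forall (ae_fourier_line_ne_zero hf hs hξ)
    · exact (isOpen_ne_fun (by fun_prop) continuous_const).measurableSet
  obtain ⟨t, ht, ht0⟩ := (hae.and (Measure.ae_ne volume (0 : ℝ))).exists
  rw [ae_iff] at ht ⊢
  have h : {v : E | ¬𝓕 f (ξ + t • v) ≠ 0} =
      (t • ·) ⁻¹' ((ξ + ·) ⁻¹' {v | ¬𝓕 f v ≠ 0}) := rfl
  rw [h, Measure.addHaar_preimage_smul _ ht0, measure_preimage_add] at ht
  simpa [ht0] using ht

/-- Smooth compactly supported functions are uniformly dense in `C₀`. -/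
theorem exists_contDiff_hasCompactSupport_near (f : ZeroAtInftyContinuousMap E ℝ) {ε : ℝ}
    (hε : 0 < ε) : ∃ g : E → ℝ, HasCompactSupport g ∧
      ContDiff ℝ ((⊤ : ℕ∞) : WithTop ℕ∞) g ∧ ∀ x, |g x - f x| ≤ ε := by
  obtain ⟨R, hR0, hR⟩ : ∃ R : ℝ, 0 < R ∧ ∀ x, R < ‖x‖ → |f x| < ε / 2 := by
    have h := f.zero_at_infty'.eventually (Metric.ball_mem_nhds 0 (half_pos hε))
    rw [← Metric.cobounded_eq_cocompact, ← comap_norm_atTop, Filter.eventually_comap] at h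
    obtain ⟨R, hR⟩ := Filter.eventually_atTop.1 h
    refine ⟨max R 1, by positivity, fun x hx ↦ ?_⟩
    simpa using hR _ ((le_max_left R 1).trans hx.le) x rfl
  let χ : ContDiffBump (0 : E) := ⟨R, R + 1, hR0, by linarith⟩
  let f₁ : E → ℝ := fun x ↦ χ x * f x
  have hf₁s : HasCompactSupport f₁ := χ.hasCompactSupport.mul_right
  have hf₁c : Continuous f₁ := χ.continuous.mul (map_continuous f)
  have hf₁ (x : E) : |f₁ x - f x| ≤ ε / 2 := by
    by_cases hx : R < ‖x‖
    · have h : f₁ x - f x = -((1 - χ x) * f x) := by simp only [f₁]; ring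
      rw [h, abs_neg, abs_mul, abs_of_nonneg (sub_nonneg.2 χ.le_one)]
      have h1 := χ.nonneg (x := x)
      nlinarith [hR x hx, abs_nonneg (f x)]
    · have h : χ x = 1 := χ.one_of_mem_closedBall (by simpa [χ] using hx)
      simpa [f₁, h] using (half_pos hε).le
  obtain ⟨δ, hδ0, hδ⟩ := Metric.uniformContinuous_iff.1
    (hf₁c.uniformContinuous_of_tendsto_cocompact hf₁s.is_zero_at_infty) _ (half_pos hε)
  let η : ContDiffBump (0 : E) := ⟨δ / 2, δ, by positivity, by linarith⟩
  refine ⟨convolution (η.normed volume) f₁ (ContinuousLinearMap.lsmul ℝ ℝ) volume,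
    η.hasCompactSupport_normed.convolution _ hf₁s,
    η.hasCompactSupport_normed.contDiff_convolution_left _ η.contDiff_normed
      hf₁c.locallyIntegrable, fun x ↦ ?_⟩
  have h := η.dist_normed_convolution_le (x₀ := x) (μ := volume) hf₁c.aestronglyMeasurable
    fun y hy ↦ (hδ hy).le
  rw [Real.dist_eq] at h
  have := abs_sub_le
    (convolution (η.normed volume) f₁ (ContinuousLinearMap.lsmul ℝ ℝ) volume x) (f₁ x) (f x)
  linarith [hf₁ x]

theorem Submodule.integral_mem_of_isClosed {α X : Type*} [MeasurableSpace α] {μ : Measure α}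
    [NormedAddCommGroup X] [NormedSpace ℝ X] [CompleteSpace X] {T : Submodule ℝ X}
    (hT : IsClosed (T : Set X)) {f : α → X} (hf : ∀ a, f a ∈ T) : ∫ a, f a ∂μ ∈ T := by
  by_cases hfi : Integrable f μ
  · by_contra hn
    obtain ⟨L, c, hL, hc⟩ := geometric_hahn_banach_point_closed T.convex hT hn
    have hLT (b : X) (hb : b ∈ T) : L b = 0 := by
      by_contra h0
      have := hc ((c / L b) • b) (T.smul_mem _ hb)
      simp [h0] at this
    have h0 : c < 0 := by simpa using hc 0 T.zero_mem
    rw [← L.integral_comp_comm hfi] at hL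
    simp only [hLT _ (hf _), integral_zero] at hL
    linarith
  · rw [integral_undef hfi]
    exact T.zero_mem

/-- A closed subspace of `C₀` containing the translates of `ψ` contains its convolutions with
integrable functions. -/
theorem exists_mem_eq_integral_translates {ψ φ : E → ℝ} (hψ : Continuous ψ)
    (hs : HasCompactSupport ψ) (hφ : Integrable φ)
    {T : Submodule ℝ (ZeroAtInftyContinuousMap E ℝ)}
    (hT : IsClosed (T : Set (ZeroAtInftyContinuousMap E ℝ)))
    (hψT : ∀ f : ZeroAtInftyContinuousMap E ℝ, ∀ t, (∀ s, f s = ψ (s - t)) → f ∈ T) :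
    ∃ F ∈ T, ∀ s, F s = ∫ t, φ t * ψ (s - t) := by
  let τ (t : E) : ZeroAtInftyContinuousMap E ℝ :=
    ⟨⟨fun s ↦ ψ (s - t), by fun_prop⟩,
      (hs.comp_homeomorph (Homeomorph.subRight t)).is_zero_at_infty⟩
  have hτ : Continuous τ := by
    rw [Metric.continuous_iff]
    intro t ε hε
    obtain ⟨δ, hδ0, hδ⟩ := Metric.uniformContinuous_iff.1
      (hψ.uniformContinuous_of_tendsto_cocompact hs.is_zero_at_infty) _ (half_pos hε)
    refine ⟨δ, hδ0, fun t' ht' ↦ ?_⟩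
    rw [← ZeroAtInftyContinuousMap.dist_toBCF_eq_dist]
    refine lt_of_le_of_lt ((BoundedContinuousFunction.dist_le (half_pos hε).le).2
      fun s ↦ (hδ ?_).le) (half_lt_self hε)
    rwa [dist_sub_left]
  obtain ⟨C, hC⟩ := hs.exists_bound_of_continuous hψ
  have hτb (t : E) : ‖τ t‖ ≤ C := by
    rw [← ZeroAtInftyContinuousMap.norm_toBCF_eq_norm]
    exact (BoundedContinuousFunction.norm_le ((norm_nonneg _).trans (hC 0))).2 fun s ↦ hC _
  have hτT (t : E) : τ t ∈ T := hψT _ t fun _ ↦ rfl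
  have hint : Integrable fun t ↦ φ t • τ t :=
    hφ.smul_bdd C hτ.aestronglyMeasurable (.of_forall hτb)
  refine ⟨∫ t, φ t • τ t, Submodule.integral_mem_of_isClosed hT fun t ↦ T.smul_mem _ (hτT t),
    fun s ↦ ?_⟩
  let ev : ZeroAtInftyContinuousMap E ℝ →L[ℝ] ℝ := LinearMap.mkContinuous
    { toFun := fun F ↦ F s, map_add' := fun _ _ ↦ rfl, map_smul' := fun _ _ ↦ rfl } 1
    fun F ↦ by
      rw [one_mul]
      exact F.toBCF.norm_coe_le_norm s
  exact (ev.integral_comp_comm hint).symm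

/-- Multiples of an almost everywhere nonvanishing smooth function `u` by test functions
approximate smooth integrable functions in `L¹`. -/
theorem exists_contDiff_integral_norm_mul_sub_lt {u g : E → ℂ}
    (hu : ContDiff ℝ ((⊤ : ℕ∞) : WithTop ℕ∞) u) (hu0 : ∀ᵐ x, u x ≠ 0)
    (hg : ContDiff ℝ ((⊤ : ℕ∞) : WithTop ℕ∞) g) (hgi : Integrable g) {ε : ℝ} (hε : 0 < ε) :
    ∃ h : E → ℂ, HasCompactSupport h ∧ ContDiff ℝ ((⊤ : ℕ∞) : WithTop ℕ∞) h ∧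
      ∫ x, ‖u x * h x - g x‖ < ε := by
  let χ (n : ℕ) : ContDiffBump (0 : E) := ⟨n + 1, n + 2, by positivity, by linarith⟩
  let w (n : ℕ) (x : E) : ℝ := χ n x * (‖u x‖ ^ 2 + 1 / ((n : ℝ) + 1))⁻¹
  let h (n : ℕ) (x : E) : ℂ := w n x • (star (u x) * g x)
  have hpos (n : ℕ) (x : E) : 0 < ‖u x‖ ^ 2 + 1 / ((n : ℝ) + 1) := by positivity
  have hw (n : ℕ) : ContDiff ℝ ((⊤ : ℕ∞) : WithTop ℕ∞) (w n) :=
    (χ n).contDiff.mul (((hu.norm_sq ℝ).add contDiff_const).inv fun x ↦ (hpos n x).ne')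
  have hhs (n : ℕ) : HasCompactSupport (h n) :=
    (χ n).hasCompactSupport.mul_right.smul_right
  have hh (n : ℕ) : ContDiff ℝ ((⊤ : ℕ∞) : WithTop ℕ∞) (h n) :=
    (hw n).smul ((Complex.conjCLE.contDiff.comp hu).mul hg)
  have heq (n : ℕ) (x : E) : u x * h n x - g x = ((w n x * ‖u x‖ ^ 2 - 1 : ℝ) : ℂ) * g x := by
    have := Complex.mul_conj' (u x)
    simp only [h, Complex.real_smul, Complex.star_def]
    push_cast
    rw [← this]
    ring
  have hbound (n : ℕ) (x : E) : ‖u x * h n x - g x‖ ≤ ‖g x‖ := by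
    rw [heq, norm_mul, Complex.norm_real]
    refine mul_le_of_le_one_left (norm_nonneg _) (abs_le.2 ?_)
    have h0 : 0 ≤ w n x * ‖u x‖ ^ 2 :=
      mul_nonneg (mul_nonneg (χ n).nonneg (inv_nonneg.2 (hpos n x).le)) (sq_nonneg _)
    have h1 : w n x * ‖u x‖ ^ 2 ≤ 1 := by
      simp only [w]
      rw [mul_assoc]
      refine mul_le_one₀ (χ n).le_one
        (mul_nonneg (inv_nonneg.2 (hpos n x).le) (sq_nonneg _)) ?_
      rw [inv_mul_le_one₀ (hpos n x)]
      have : 0 < 1 / ((n : ℝ) + 1) := by positivity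
      linarith
    constructor <;> linarith
  have hlim : Filter.Tendsto (fun n ↦ ∫ x, ‖u x * h n x - g x‖) Filter.atTop
      (nhds (∫ _ : E, (0 : ℝ))) := by
    refine tendsto_integral_of_dominated_convergence (fun x ↦ ‖g x‖)
      (fun n ↦ ((hu.continuous.mul (hh n).continuous).sub
        hg.continuous).norm.aestronglyMeasurable) hgi.norm
      (fun n ↦ .of_forall fun x ↦ by simpa using hbound n x) ?_
    filter_upwards [hu0] with x hx
    have hux : ‖u x‖ ^ 2 ≠ 0 := by simpa using hx
    have hχ : ∀ᶠ n in Filter.atTop, χ n x = 1 := by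
      obtain ⟨N, hN⟩ := exists_nat_ge ‖x‖
      filter_upwards [Filter.eventually_ge_atTop N] with n hn
      refine (χ n).one_of_mem_closedBall ?_
      have : (N : ℝ) ≤ n := by exact_mod_cast hn
      simp only [χ, mem_closedBall_zero_iff]
      linarith
    have hwlim : Filter.Tendsto (fun n ↦ w n x) Filter.atTop (nhds (1 * (‖u x‖ ^ 2 + 0)⁻¹)) :=
      (tendsto_const_nhds.congr' (hχ.mono fun n hn ↦ hn.symm)).mul
        ((tendsto_const_nhds.add tendsto_one_div_add_atTop_nhds_zero_nat).inv₀ (by simpa using hx))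
    have hlim₁ : Filter.Tendsto (fun n ↦ |w n x * ‖u x‖ ^ 2 - 1| * ‖g x‖) Filter.atTop
        (nhds (|1 * (‖u x‖ ^ 2 + 0)⁻¹ * ‖u x‖ ^ 2 - 1| * ‖g x‖)) :=
      (((hwlim.mul_const _).sub_const 1).abs).mul_const _
    simpa only [heq, norm_mul, Complex.norm_real, Real.norm_eq_abs, add_zero, one_mul,
      inv_mul_cancel₀ hux, sub_self, abs_zero, zero_mul] using hlim₁
  rw [integral_zero] at hlim
  obtain ⟨n, hn⟩ := (hlim.eventually_lt_const hε).exists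
  exact ⟨h n, hhs n, hh n, hn⟩

/-- If the Fourier transform of `ψ` is nonzero almost everywhere, convolutions with `ψ` approximate
test functions uniformly. -/
theorem exists_integrable_convolution_near {ψ f : E → ℝ} (hψ : Continuous ψ)
    (hs : HasCompactSupport ψ) (hne : ∀ᵐ ξ, 𝓕 (fun x ↦ (ψ x : ℂ)) ξ ≠ 0)
    (hu : ContDiff ℝ ((⊤ : ℕ∞) : WithTop ℕ∞) (𝓕 fun x ↦ (ψ x : ℂ)))
    (hf : ContDiff ℝ ((⊤ : ℕ∞) : WithTop ℕ∞) f)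
    (hfs : HasCompactSupport f) {ε : ℝ} (hε : 0 < ε) :
    ∃ φ : E → ℝ, Integrable φ ∧ ∀ s, |(∫ t, φ t * ψ (s - t)) - f s| ≤ ε := by
  set ψc : E → ℂ := fun x ↦ ψ x with hψc
  have hψcc : Continuous ψc := by fun_prop
  have hψcs : HasCompactSupport ψc := hs.comp_left Complex.ofReal_zero
  have hψci := hψcc.integrable_of_hasCompactSupport (μ := volume) hψcs
  let fc : SchwartzMap E ℂ := HasCompactSupport.toSchwartzMap (f := fun x ↦ (f x : ℂ))
    (hfs.comp_left Complex.ofReal_zero) (Complex.ofRealCLM.contDiff.comp hf)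
  let G : SchwartzMap E ℂ := 𝓕 fc
  obtain ⟨h, hhs, hh, hlt⟩ := exists_contDiff_integral_norm_mul_sub_lt hu hne
    (G.smooth ⊤) G.integrable hε
  let H : SchwartzMap E ℂ := hhs.toSchwartzMap hh
  let Φ : SchwartzMap E ℂ := 𝓕⁻ H
  have hΦ : 𝓕 (Φ : E → ℂ) = h := by
    rw [← SchwartzMap.fourier_coe]
    simp only [Φ, FourierTransform.fourier_fourierInv_eq]
    rfl
  let c : E → ℂ := convolution Φ ψc (ContinuousLinearMap.mul ℂ ℂ) volume
  have hci : Integrable c := Φ.integrable.integrable_convolution _ hψci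
  have hcc : Continuous c := hψcs.continuous_convolution_right _
    Φ.continuous.locallyIntegrable hψcc
  have hFc : 𝓕 c = fun x ↦ 𝓕 ψc x * h x := by
    ext x
    rw [Real.fourier_mul_convolution_eq Φ.integrable hψci, hΦ, mul_comm]
  have hFci : Integrable fun x ↦ 𝓕 ψc x * h x :=
    (hu.continuous.mul hh.continuous).integrable_of_hasCompactSupport hhs.mul_left
  have hcinv : 𝓕⁻ (𝓕 c) = c := hcc.fourierInv_fourier_eq hci (hFc ▸ hFci)
  have hfinv : 𝓕⁻ (G : E → ℂ) = fc := by
    rw [← SchwartzMap.fourierInv_coe]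
    simp only [G, FourierTransform.fourierInv_fourier_eq]
  have hcf (s : E) : ‖c s - f s‖ ≤ ε := by
    have h1 : c s - f s = 𝓕⁻ (fun x ↦ 𝓕 ψc x * h x - G x) s := by
      have h2 : (f s : ℂ) = 𝓕⁻ (G : E → ℂ) s := by rw [hfinv]; rfl
      rw [h2, ← hcinv, hFc, Real.fourierInv_eq, Real.fourierInv_eq, Real.fourierInv_eq,
        ← integral_sub]
      · simp only [smul_sub]
      · simpa using (Real.fourierIntegral_convergent_iff (-s)).2 hFci
      · simpa using (Real.fourierIntegral_convergent_iff (-s)).2 G.integrable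
    rw [h1, Real.fourierInv_eq]
    refine (norm_integral_le_integral_norm _).trans (le_trans (le_of_eq ?_) hlt.le)
    simp
  refine ⟨fun t ↦ (Φ t).re, Φ.integrable.re, fun s ↦ ?_⟩
  have hre : (c s).re = ∫ t, (Φ t).re * ψ (s - t) := by
    have hex : Integrable fun t ↦ Φ t * ψc (s - t) :=
      (Φ.continuous.mul (by fun_prop)).integrable_of_hasCompactSupport
        (hψcs.comp_homeomorph (Homeomorph.subLeft s)).mul_left
    calc (c s).re = ∫ t, (Φ t * ψc (s - t)).re := (integral_re hex).symm
      _ = _ := by simp [hψc]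
  rw [← hre]
  simpa using (Complex.abs_re_le_norm (c s - f s)).trans (hcf s)

end Translates

/-- let `ψ : ℝ^d → ℝ` be continuous, compactly supported and not identically
zero. Then the span of the translates `{ψ(· − t) : t ∈ ℝ^d}` is dense in `C₀(ℝ^d)` for the
supremum norm. -/
theorem stmt10 (d : ℕ) (ψ : EuclideanSpace ℝ (Fin d) → ℝ)
    (hcont : Continuous ψ) (hsupp : HasCompactSupport ψ) (hne : ψ ≠ 0) :
    Dense (↑(Submodule.span ℝ
      {f : ZeroAtInftyContinuousMap (EuclideanSpace ℝ (Fin d)) ℝ |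
        ∃ t : EuclideanSpace ℝ (Fin d), ∀ s, f s = ψ (s - t)}) :
      Set (ZeroAtInftyContinuousMap (EuclideanSpace ℝ (Fin d)) ℝ)) := by
  have hψc : Continuous fun x ↦ (ψ x : ℂ) := by fun_prop
  have hψs : HasCompactSupport fun x ↦ (ψ x : ℂ) := hsupp.comp_left Complex.ofReal_zero
  have hψ0 : (fun x ↦ (ψ x : ℂ)) ≠ 0 := fun h ↦
    hne (funext fun x ↦ Complex.ofReal_eq_zero.1 (congrFun h x))
  suffices H : ∀ V : Submodule ℝ (ZeroAtInftyContinuousMap (EuclideanSpace ℝ (Fin d)) ℝ),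
      (∀ f : ZeroAtInftyContinuousMap (EuclideanSpace ℝ (Fin d)) ℝ, ∀ t,
        (∀ s, f s = ψ (s - t)) → f ∈ V) →
      Dense (V : Set (ZeroAtInftyContinuousMap (EuclideanSpace ℝ (Fin d)) ℝ)) from
    H _ fun f t hf ↦ Submodule.subset_span ⟨t, hf⟩
  intro V hV f
  rw [← Submodule.topologicalClosure_coe, ← (Submodule.isClosed_topologicalClosure _).closure_eq,
    Metric.mem_closure_iff]
  intro ε hε
  obtain ⟨g, hgs, hg, hgf⟩ := exists_contDiff_hasCompactSupport_near f (ε := ε / 3) (by positivity)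
  obtain ⟨φ, hφ, hφg⟩ := exists_integrable_convolution_near hcont hsupp
    (ae_fourier_ne_zero hψc hψs hψ0) (contDiff_fourier_of_hasCompactSupport hψc hψs) hg hgs
    (ε := ε / 3) (by positivity)
  obtain ⟨F, hFT, hF⟩ := exists_mem_eq_integral_translates hcont hsupp hφ
    V.isClosed_topologicalClosure fun f t hf ↦ V.le_topologicalClosure (hV f t hf)
  refine ⟨F, hFT, ?_⟩
  rw [dist_comm, ← ZeroAtInftyContinuousMap.dist_toBCF_eq_dist]
  refine lt_of_le_of_lt ((BoundedContinuousFunction.dist_le (by positivity)).2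
    fun s ↦ ?_) (by linarith : ε / 3 + ε / 3 < ε)
  change |F s - f s| ≤ _
  rw [hF]
  exact (abs_sub_le _ (g s) _).trans (add_le_add (hφg s) (hgf s))
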